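/- arXiv:2301.03482 — 5 statements merged into one kernel-verified Lean document; each statement's English description precedes it below -/
import Mathlib

section
/- Let U be uniformly distributed on S^{d-1}. Then for all b, c ∈ S^{d-1}, E[(b·U)³(c·U)³] = (6(b·c)³ + 9(b·c))/(d(d+2)(d+4)). -/
open MeasureTheory Real
open scoped InnerProductSpace

/-- The spherical Lebesgue (surface) measure `σ` on the unit sphere
`S^{d-1} = {x ∈ ℝ^d : ‖x‖ = 1}`. -/
noncomputable def sphereMeasure (d : ℕ) :
    Measure (Metric.sphere (0 : EuclideanSpace ℝ (Fin d)) 1) :=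
  (volume : Measure (EuclideanSpace ℝ (Fin d))).toSphere

/-- Expectation `E g(U) = |S^{d-1}|⁻¹ ∫_{S^{d-1}} g(u) dσ(u)` of `g(U)` for `U`
uniformly distributed on the sphere `S^{d-1}`. -/
noncomputable def unifExp (d : ℕ)
    (g : Metric.sphere (0 : EuclideanSpace ℝ (Fin d)) 1 → ℝ) : ℝ :=
  ((sphereMeasure d) Set.univ).toReal⁻¹ * ∫ u, g u ∂(sphereMeasure d)

open Module in
/-- Polar integration of a positively homogeneous function against the Gaussian weight. -/
lemma integral_mul_exp_neg_sq_norm_of_homogeneous {E : Type*} [NormedAddCommGroup E]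
    [NormedSpace ℝ E] [FiniteDimensional ℝ E] [Nontrivial E] [MeasurableSpace E] [BorelSpace E]
    (μ : Measure E) [μ.IsAddHaarMeasure] (k : ℕ) (f : E → ℝ)
    (hf : ∀ (r : ℝ) (x : E), 0 < r → f (r • x) = r ^ k * f x) :
    ∫ x, f x * exp (-‖x‖ ^ 2) ∂μ
      = (∫ u : Metric.sphere (0 : E) 1, f u ∂μ.toSphere)
        * (Gamma (((finrank ℝ E : ℝ) + k) / 2) / 2) := by
  have hpos : 0 < finrank ℝ E := finrank_pos
  calc
    ∫ x, f x * exp (-‖x‖ ^ 2) ∂μ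
        = ∫ x : ({(0 : E)}ᶜ : Set E), f x * exp (-‖x.1‖ ^ 2) ∂(μ.comap (↑)) := by
      rw [integral_subtype_comap (measurableSet_singleton _).compl
        fun x ↦ f x * exp (-‖x‖ ^ 2), restrict_compl_singleton]
    _ = ∫ p, f p.1 * (p.2.1 ^ k * exp (-p.2.1 ^ 2))
          ∂μ.toSphere.prod (.volumeIoiPow (finrank ℝ E - 1)) := by
      rw [← μ.measurePreserving_homeomorphUnitSphereProd.integral_comp
        (Homeomorph.measurableEmbedding _)]
      refine integral_congr_ae (.of_forall fun x ↦ ?_)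
      have hx : 0 < ‖x.1‖ := norm_pos_iff.2 x.2
      have h := hf ‖x.1‖ (‖x.1‖⁻¹ • x.1) hx
      rw [smul_inv_smul₀ hx.ne'] at h
      simp only [homeomorphUnitSphereProd_apply_snd_coe, homeomorphUnitSphereProd_apply_fst_coe]
      rw [h]
      ring
    _ = (∫ u : Metric.sphere (0 : E) 1, f u ∂μ.toSphere)
          * ∫ r : Set.Ioi (0 : ℝ), r.1 ^ k * exp (-r.1 ^ 2)
            ∂.volumeIoiPow (finrank ℝ E - 1) :=
      integral_prod_mul (fun u : Metric.sphere (0 : E) 1 ↦ f u)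
        (fun r : Set.Ioi (0 : ℝ) ↦ r.1 ^ k * exp (-r.1 ^ 2))
    _ = _ := by
      congr 1
      simp only [Measure.volumeIoiPow, ENNReal.ofReal]
      rw [integral_withDensity_eq_integral_smul
          (measurable_subtype_coe.pow_const _).real_toNNReal,
        integral_subtype_comap measurableSet_Ioi
          fun a ↦ Real.toNNReal (a ^ (finrank ℝ E - 1)) • (a ^ k * exp (-a ^ 2))]
      have hG := integral_rpow_mul_exp_neg_rpow (p := 2) (q := (finrank ℝ E : ℝ) - 1 + k)
        two_pos (by
          have : (0 : ℝ) < finrank ℝ E := by exact_mod_cast hpos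
          have : (0 : ℝ) ≤ k := k.cast_nonneg
          linarith)
      rw [show ((finrank ℝ E : ℝ) - 1 + k + 1) / 2 = ((finrank ℝ E : ℝ) + k) / 2 by ring] at hG
      rw [div_eq_inv_mul, inv_eq_one_div, ← hG]
      refine setIntegral_congr_fun measurableSet_Ioi fun x hx ↦ ?_
      have hx0 : 0 < x := hx
      simp only [NNReal.smul_def, smul_eq_mul]
      rw [Real.coe_toNNReal _ (pow_nonneg hx0.le _), ← mul_assoc, ← pow_add,
        ← Nat.cast_pred hpos, ← Nat.cast_add, rpow_natCast, rpow_two]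

lemma integral_pow_six_mul_exp_neg_sq : ∫ x : ℝ, x ^ 6 * exp (-x ^ 2) = 15 / 8 * √π := by
  have h := integral_comp_abs (f := fun x : ℝ ↦ x ^ 6 * exp (-x ^ 2))
  simp only [sq_abs, Even.pow_abs (show Even 6 by decide)] at h
  have hG := integral_rpow_mul_exp_neg_rpow (p := 2) (q := 6) two_pos (by norm_num)
  have hΓ : Gamma ((6 + 1) / 2) = 15 / 8 * √π := by
    rw [show ((6 : ℝ) + 1) / 2 = 1 / 2 + 1 + 1 + 1 by norm_num, Gamma_add_one (by norm_num),
      Gamma_add_one (by norm_num), Gamma_add_one (by norm_num), Gamma_one_half_eq]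
    ring
  simp only [rpow_ofNat] at hG
  rw [h, hG, hΓ]
  ring

/-- The sixth moment of a linear functional under the unnormalised Gaussian weight. -/
lemma integral_inner_pow_six_mul_exp_neg_sq_norm (d : ℕ) (v : EuclideanSpace ℝ (Fin d)) :
    ∫ x : EuclideanSpace ℝ (Fin d), ⟪v, x⟫_ℝ ^ 6 * exp (-‖x‖ ^ 2)
      = 15 / 8 * ‖v‖ ^ 6 * √π ^ d := by
  rcases eq_or_ne v 0 with rfl | hv
  · simp
  have hv' : ‖v‖ ≠ 0 := norm_ne_zero_iff.2 hv
  obtain ⟨d, rfl⟩ : ∃ n, d = n + 1 := Nat.exists_eq_succ_of_ne_zero (by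
    rintro rfl
    exact hv (Subsingleton.elim _ _))
  have hon : Orthonormal ℝ (Set.domRestrict {(0 : Fin (d + 1))}
      (fun _ ↦ ‖v‖⁻¹ • v : Fin (d + 1) → EuclideanSpace ℝ (Fin (d + 1)))) := by
    refine ⟨fun i ↦ by simp [Set.domRestrict, norm_smul, hv'], fun i j hij ↦ (hij (Subsingleton.elim _ _)).elim⟩
  obtain ⟨e, he⟩ := hon.exists_orthonormalBasis_extension_of_card_eq (by simp)
  have he0 : e 0 = ‖v‖⁻¹ • v := he 0 rfl
  have hve (x : EuclideanSpace ℝ (Fin (d + 1))) : ⟪v, e.repr.symm x⟫_ℝ = ‖v‖ * x 0 := by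
    have h : ⟪e 0, e.repr.symm x⟫_ℝ = x 0 := by
      rw [← e.repr_apply_apply, LinearIsometryEquiv.apply_symm_apply]
    rw [← h, he0, real_inner_smul_left, mul_inv_cancel_left₀ hv']
  rw [← e.measurePreserving_repr_symm.integral_comp
    e.repr.symm.toHomeomorph.measurableEmbedding]
  rw [← (PiLp.volume_preserving_toLp (Fin (d + 1))).integral_comp
    (MeasurableEquiv.toLp 2 _).measurableEmbedding]
  have hprod (x : Fin (d + 1) → ℝ) :
      ⟪v, e.repr.symm (WithLp.toLp 2 x)⟫_ℝ ^ 6 * exp (-‖e.repr.symm (WithLp.toLp 2 x)‖ ^ 2)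
        = ‖v‖ ^ 6 * ∏ i, (if i = 0 then x i ^ 6 else 1) * exp (-x i ^ 2) := by
    rw [hve, LinearIsometryEquiv.norm_map, EuclideanSpace.real_norm_sq_eq, Finset.prod_mul_distrib,
      ← exp_sum, Finset.sum_neg_distrib]
    simp
    ring
  simp only [hprod]
  rw [integral_const_mul, integral_fintype_prod_volume_eq_prod
    (fun (i : Fin (d + 1)) (y : ℝ) ↦ (if i = 0 then y ^ 6 else 1) * exp (-y ^ 2)),
    Fin.prod_univ_succ]
  have h0 : ∫ y : ℝ, exp (-y ^ 2) = √π := by simpa using integral_gaussian 1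
  simp [Fin.succ_ne_zero, h0, integral_pow_six_mul_exp_neg_sq]
  ring

lemma integral_exp_neg_sq_norm (d : ℕ) :
    ∫ x : EuclideanSpace ℝ (Fin d), exp (-‖x‖ ^ 2) = √π ^ d := by
  have h := GaussianFourier.integral_rexp_neg_mul_sq_norm (V := EuclideanSpace ℝ (Fin d)) one_pos
  simp only [neg_mul, one_mul, div_one, finrank_euclideanSpace, Fintype.card_fin] at h
  rw [h, sqrt_eq_rpow, ← rpow_natCast, ← rpow_mul pi_nonneg]
  ring_nf

/-- The sixth moment of a linear functional with respect to the surface measure. -/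
lemma integral_inner_pow_six_sphereMeasure {d : ℕ} (hd : 2 ≤ d) (v : EuclideanSpace ℝ (Fin d)) :
    ∫ u, ⟪v, (u : EuclideanSpace ℝ (Fin d))⟫_ℝ ^ 6 ∂sphereMeasure d
      = 15 * (sphereMeasure d).real Set.univ / (d * (d + 2) * (d + 4)) * ‖v‖ ^ 6 := by
  have : NeZero d := ⟨by omega⟩
  have hd0 : (0 : ℝ) < d := by exact_mod_cast (by omega : 0 < d)
  have h6 := integral_mul_exp_neg_sq_norm_of_homogeneous
    (volume : Measure (EuclideanSpace ℝ (Fin d))) 6 (fun x ↦ ⟪v, x⟫_ℝ ^ 6)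
    (fun r x _ ↦ by rw [real_inner_smul_right, mul_pow])
  have h0 := integral_mul_exp_neg_sq_norm_of_homogeneous
    (volume : Measure (EuclideanSpace ℝ (Fin d))) 0 (fun _ ↦ 1) (by simp)
  have hΓ : Gamma (((d : ℝ) + (6 : ℕ)) / 2)
      = d * (d + 2) * (d + 4) / 8 * Gamma (d / 2) := by
    rw [show ((d : ℝ) + (6 : ℕ)) / 2 = d / 2 + 1 + 1 + 1 by push_cast; ring,
      Gamma_add_one (by positivity), Gamma_add_one (by positivity),
      Gamma_add_one (by positivity)]
    ring
  rw [integral_inner_pow_six_mul_exp_neg_sq_norm, finrank_euclideanSpace, Fintype.card_fin,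
    hΓ] at h6
  simp only [one_mul, integral_exp_neg_sq_norm, finrank_euclideanSpace, Fintype.card_fin,
    Nat.cast_zero, add_zero, integral_const, smul_eq_mul, mul_one] at h0
  rw [h0] at h6
  have hG : 0 < Gamma ((d : ℝ) / 2) := Gamma_pos_of_pos (by positivity)
  unfold sphereMeasure
  field_simp
  field_simp at h6
  linarith

/-- Mixed moment formula for projections of a uniform random vector on the sphere. -/
theorem eta_three (d : ℕ) (hd : 2 ≤ d)
    (b c : Metric.sphere (0 : EuclideanSpace ℝ (Fin d)) 1) :
    unifExp d (fun u => ⟪(b : EuclideanSpace ℝ (Fin d)), (u : EuclideanSpace ℝ (Fin d))⟫_ℝ ^ 3 * ⟪(c : EuclideanSpace ℝ (Fin d)), (u : EuclideanSpace ℝ (Fin d))⟫_ℝ ^ 3)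
      = (6 * ⟪(b : EuclideanSpace ℝ (Fin d)), (c : EuclideanSpace ℝ (Fin d))⟫_ℝ ^ 3 + 9 * ⟪(b : EuclideanSpace ℝ (Fin d)), (c : EuclideanSpace ℝ (Fin d))⟫_ℝ) / ((d : ℝ) * ((d : ℝ) + 2) * ((d : ℝ) + 4)) := by
  have : NeZero d := ⟨by omega⟩
  have hd0 : (0 : ℝ) < d := by exact_mod_cast (by omega : 0 < d)
  have : IsFiniteMeasure (sphereMeasure d) := by unfold sphereMeasure; infer_instance
  have hσ : (sphereMeasure d).real Set.univ ≠ 0 := by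
    rw [measureReal_ne_zero_iff, Measure.measure_univ_ne_zero]
    exact Measure.toSphere_ne_zero _
  obtain ⟨b, hb⟩ := b
  obtain ⟨c, hc⟩ := c
  rw [mem_sphere_zero_iff_norm] at hb hc
  simp only
  have hint (v : EuclideanSpace ℝ (Fin d)) : Integrable
      (fun u : Metric.sphere (0 : EuclideanSpace ℝ (Fin d)) 1 ↦
        ⟪v, (u : EuclideanSpace ℝ (Fin d))⟫_ℝ ^ 6) (sphereMeasure d) :=
    Continuous.integrable_of_hasCompactSupport (by fun_prop) (HasCompactSupport.of_compactSpace _)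
  have hnorm (s t : ℝ) : ‖s • b + t • c‖ ^ 6 = (s ^ 2 + 2 * s * t * ⟪b, c⟫_ℝ + t ^ 2) ^ 3 := by
    rw [show ‖s • b + t • c‖ ^ 6 = (‖s • b + t • c‖ ^ 2) ^ 3 by ring, norm_add_sq_real,
      norm_smul, norm_smul, hb, hc, real_inner_smul_left, real_inner_smul_right,
      mul_one, mul_one, norm_eq_abs, norm_eq_abs, sq_abs, sq_abs]
    ring
  -- Polarization of the sixth power.
  have hpol (u : Metric.sphere (0 : EuclideanSpace ℝ (Fin d)) 1) :
      ⟪b, (u : EuclideanSpace ℝ (Fin d))⟫_ℝ ^ 3 * ⟪c, (u : EuclideanSpace ℝ (Fin d))⟫_ℝ ^ 3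
        = 1 / 720 * (34 * (⟪(1 : ℝ) • b + (1 : ℝ) • c, (u : EuclideanSpace ℝ (Fin d))⟫_ℝ ^ 6
            - ⟪(1 : ℝ) • b + (-1 : ℝ) • c, (u : EuclideanSpace ℝ (Fin d))⟫_ℝ ^ 6)
          - (⟪(2 : ℝ) • b + (1 : ℝ) • c, (u : EuclideanSpace ℝ (Fin d))⟫_ℝ ^ 6
            - ⟪(2 : ℝ) • b + (-1 : ℝ) • c, (u : EuclideanSpace ℝ (Fin d))⟫_ℝ ^ 6)
          - (⟪(1 : ℝ) • b + (2 : ℝ) • c, (u : EuclideanSpace ℝ (Fin d))⟫_ℝ ^ 6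
            - ⟪(1 : ℝ) • b + (-2 : ℝ) • c, (u : EuclideanSpace ℝ (Fin d))⟫_ℝ ^ 6)) := by
    simp only [inner_add_left, real_inner_smul_left]
    ring
  have hsub {f g : Metric.sphere (0 : EuclideanSpace ℝ (Fin d)) 1 → ℝ}
      (hf : Integrable f (sphereMeasure d)) (hg : Integrable g (sphereMeasure d)) :
      Integrable (fun u ↦ f u - g u) (sphereMeasure d) := hf.sub hg
  have hdiff (v w : EuclideanSpace ℝ (Fin d)) := hsub (hint v) (hint w)
  unfold unifExp
  simp only [hpol]
  rw [integral_const_mul,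
    integral_sub (hsub ((hdiff _ _).const_mul _) (hdiff _ _)) (hdiff _ _),
    integral_sub ((hdiff _ _).const_mul _) (hdiff _ _), integral_const_mul,
    integral_sub (hint _) (hint _), integral_sub (hint _) (hint _),
    integral_sub (hint _) (hint _)]
  simp only [integral_inner_pow_six_sphereMeasure hd, hnorm]
  rw [← measureReal_def]
  field_simp
  ring
end

section
/- Let U be uniformly distributed on S^{d-1}. Then for all b, c ∈ S^{d-1}, E[(b·U)⁴(c·U)⁴] = (24(b·c)⁴ + 72(b·c)² + 9) / (d(d+2)(d+4)(d+6)). -/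
open MeasureTheory Real
open scoped InnerProductSpace

/-- The half-line Gaussian moment `∫_0^∞ r ^ n * exp (-r²) dr`. -/
noncomputable def halfGaussianMoment (n : ℕ) : ℝ :=
  ∫ r in Set.Ioi (0 : ℝ), r ^ n * exp (-r ^ 2)

lemma halfGaussianMoment_eq_Gamma (n : ℕ) :
    halfGaussianMoment n = 1 / 2 * Gamma ((n + 1) / 2) := by
  have h := integral_rpow_mul_exp_neg_rpow (p := 2) (q := n) two_pos
    (by have := n.cast_nonneg (α := ℝ); linarith)
  simpa [halfGaussianMoment] using h

lemma halfGaussianMoment_pos (n : ℕ) : 0 < halfGaussianMoment n := by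
  rw [halfGaussianMoment_eq_Gamma]
  have := Gamma_pos_of_pos (s := ((n : ℝ) + 1) / 2) (by positivity)
  positivity

lemma halfGaussianMoment_add_two (n : ℕ) :
    halfGaussianMoment (n + 2) = (n + 1) / 2 * halfGaussianMoment n := by
  have h := Gamma_add_one (s := ((n : ℝ) + 1) / 2) (by positivity)
  rw [halfGaussianMoment_eq_Gamma, halfGaussianMoment_eq_Gamma]
  push_cast
  rw [show ((n : ℝ) + 2 + 1) / 2 = (n + 1) / 2 + 1 by ring, h]
  ring

lemma halfGaussianMoment_add_eight (n : ℕ) :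
    halfGaussianMoment (n + 8) =
      (n + 1) * (n + 3) * (n + 5) * (n + 7) / 16 * halfGaussianMoment n := by
  rw [halfGaussianMoment_add_two (n + 6), halfGaussianMoment_add_two (n + 4),
    halfGaussianMoment_add_two (n + 2), halfGaussianMoment_add_two n]
  push_cast
  ring

lemma integral_pow_mul_exp_neg_sq {n : ℕ} (hn : Even n) :
    ∫ x : ℝ, x ^ n * exp (-x ^ 2) = 2 * halfGaussianMoment n := by
  have h := integral_comp_abs (f := fun x : ℝ => x ^ n * exp (-x ^ 2))
  simpa [hn.pow_abs, halfGaussianMoment] using h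

lemma integral_inner_pow_mul_exp_eq_toSphere {E : Type*} [NormedAddCommGroup E]
    [InnerProductSpace ℝ E] [FiniteDimensional ℝ E] [Nontrivial E] [MeasurableSpace E]
    [BorelSpace E] (μ : Measure E) [μ.IsAddHaarMeasure] (v : E) (n : ℕ) :
    ∫ x, ⟪v, x⟫_ℝ ^ n * exp (-‖x‖ ^ 2) ∂μ =
      (∫ u, ⟪v, (u : E)⟫_ℝ ^ n ∂μ.toSphere) *
        halfGaussianMoment (Module.finrank ℝ E - 1 + n) := by
  calc
    _ = ∫ x : ({(0)}ᶜ : Set E), ⟪v, (x : E)⟫_ℝ ^ n * exp (-‖(x : E)‖ ^ 2) ∂(μ.comap (↑)) := by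
      rw [integral_subtype_comap (measurableSet_singleton _).compl
        fun x : E ↦ ⟪v, x⟫_ℝ ^ n * exp (-‖x‖ ^ 2), restrict_compl_singleton]
    _ = ∫ p, ⟪v, (p.1 : E)⟫_ℝ ^ n * ((p.2 : ℝ) ^ n * exp (-(p.2 : ℝ) ^ 2))
          ∂μ.toSphere.prod (.volumeIoiPow (Module.finrank ℝ E - 1)) := by
      rw [← μ.measurePreserving_homeomorphUnitSphereProd.integral_comp
        (Homeomorph.measurableEmbedding _)]
      refine integral_congr_ae (.of_forall fun x => ?_)
      have hx : ‖(x : E)‖ ≠ 0 := norm_ne_zero_iff.2 x.2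
      simp only [homeomorphUnitSphereProd_apply_fst_coe, homeomorphUnitSphereProd_apply_snd_coe,
        inner_smul_right]
      rw [mul_pow, inv_pow]
      field_simp
    _ = (∫ u, ⟪v, (u : E)⟫_ℝ ^ n ∂μ.toSphere) * ∫ r : Set.Ioi (0 : ℝ),
          (r : ℝ) ^ n * exp (-(r : ℝ) ^ 2) ∂.volumeIoiPow (Module.finrank ℝ E - 1) :=
      integral_prod_mul (fun u : Metric.sphere (0 : E) 1 => ⟪v, (u : E)⟫_ℝ ^ n)
        (fun r : Set.Ioi (0 : ℝ) => (r : ℝ) ^ n * exp (-(r : ℝ) ^ 2))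
    _ = _ := by
      congr 1
      simp only [Measure.volumeIoiPow, ENNReal.ofReal]
      rw [integral_withDensity_eq_integral_smul
          (measurable_subtype_coe.pow_const _).real_toNNReal,
        integral_subtype_comap measurableSet_Ioi fun a : ℝ ↦
          Real.toNNReal (a ^ (Module.finrank ℝ E - 1)) • (a ^ n * exp (-a ^ 2)),
        halfGaussianMoment]
      refine setIntegral_congr_fun measurableSet_Ioi fun x hx ↦ ?_
      simp only [NNReal.smul_def, Real.coe_toNNReal _ (pow_nonneg (Set.mem_Ioi.1 hx).le _),
        smul_eq_mul]
      ring

lemma integral_coord_pow_mul_exp {ι : Type*} [Fintype ι] [DecidableEq ι] (i : ι)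
    {n : ℕ} (hn : Even n) :
    ∫ x : EuclideanSpace ℝ ι, x i ^ n * exp (-‖x‖ ^ 2) =
      (2 * halfGaussianMoment n) * (2 * halfGaussianMoment 0) ^ (Fintype.card ι - 1) := by
  rw [← (PiLp.volume_preserving_toLp ι).integral_comp (MeasurableEquiv.toLp 2 _).measurableEmbedding]
  have h (x : ι → ℝ) : (WithLp.toLp 2 x : EuclideanSpace ℝ ι) i ^ n *
      exp (-‖(WithLp.toLp 2 x : EuclideanSpace ℝ ι)‖ ^ 2) =
      ∏ j, x j ^ (if j = i then n else 0) * exp (-x j ^ 2) := by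
    rw [EuclideanSpace.norm_sq_eq, Finset.prod_mul_distrib, ← exp_sum]
    simp [Finset.prod_ite_eq', apply_ite]
  simp_rw [h]
  rw [integral_fintype_prod_volume_eq_prod
    (fun j (y : ℝ) => y ^ (if j = i then n else 0) * exp (-y ^ 2)),
    ← Finset.mul_prod_erase _ _ (Finset.mem_univ i)]
  congr 1
  · simpa using integral_pow_mul_exp_neg_sq hn
  · rw [Finset.prod_congr rfl (g := fun _ => 2 * halfGaussianMoment 0)]
    · simp [Finset.card_erase_of_mem]
    · intro j hj
      simpa [Finset.ne_of_mem_erase hj] using integral_pow_mul_exp_neg_sq (Even.zero (α := ℕ))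

lemma integral_inner_pow_mul_exp {E : Type*} [NormedAddCommGroup E]
    [InnerProductSpace ℝ E] [FiniteDimensional ℝ E] [MeasurableSpace E]
    [BorelSpace E] {v : E} (hv : ‖v‖ = 1) {n : ℕ} (hn : Even n) :
    ∫ x, ⟪v, x⟫_ℝ ^ n * exp (-‖x‖ ^ 2) =
      (2 * halfGaussianMoment n) * (2 * halfGaussianMoment 0) ^ (Module.finrank ℝ E - 1) := by
  classical
  have hon : Orthonormal ℝ ((↑) : ({v} : Set E) → E) := by
    simpa using hv
  obtain ⟨s, b, hs, hb⟩ := hon.exists_orthonormalBasis_extension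
  let i : s := ⟨v, hs (Set.mem_singleton v)⟩
  have hbi : b i = v := congrFun hb i
  rw [Module.finrank_eq_card_basis b.toBasis, ← integral_coord_pow_mul_exp i hn,
    ← b.measurePreserving_repr.integral_comp b.repr.toHomeomorph.measurableEmbedding]
  refine integral_congr_ae (.of_forall fun x => ?_)
  simp [b.repr_apply_apply, hbi]

lemma integral_toSphere_inner_pow_eight {E : Type*} [NormedAddCommGroup E]
    [InnerProductSpace ℝ E] [FiniteDimensional ℝ E] [Nontrivial E] [MeasurableSpace E]
    [BorelSpace E] (v : E) :
    ∫ u, ⟪v, (u : E)⟫_ℝ ^ 8 ∂(volume : Measure E).toSphere =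
      105 / ((Module.finrank ℝ E : ℝ) * (Module.finrank ℝ E + 2) * (Module.finrank ℝ E + 4) *
        (Module.finrank ℝ E + 6)) * (volume : Measure E).toSphere.real Set.univ * ‖v‖ ^ 8 := by
  rcases eq_or_ne v 0 with rfl | hv
  · simp
  have hv' : ‖v‖ ≠ 0 := norm_ne_zero_iff.2 hv
  have he : ‖(‖v‖⁻¹ • v)‖ = 1 := by simp [norm_smul, hv']
  set e := ‖v‖⁻¹ • v with he_def
  have hve : v = ‖v‖ • e := by simp [he_def, smul_smul, hv']
  have h8 := integral_inner_pow_mul_exp he (n := 8) (by decide)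
  have h0 := integral_inner_pow_mul_exp he (n := 0) (by decide)
  rw [integral_inner_pow_mul_exp_eq_toSphere] at h8 h0
  have hd : 0 < Module.finrank ℝ E := Module.finrank_pos
  have hS : ∫ u, ⟪v, (u : E)⟫_ℝ ^ 8 ∂(volume : Measure E).toSphere =
      ‖v‖ ^ 8 * ∫ u, ⟪e, (u : E)⟫_ℝ ^ 8 ∂(volume : Measure E).toSphere := by
    rw [← integral_const_mul]
    refine integral_congr_ae (.of_forall fun u => ?_)
    dsimp only
    rw [← mul_pow, ← real_inner_smul_left, ← hve]
  rw [hS]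
  generalize Module.finrank ℝ E = d at *
  obtain ⟨m, rfl⟩ : ∃ m, d = m + 1 := ⟨d - 1, by omega⟩
  have hK := halfGaussianMoment_pos m
  simp only [Nat.add_sub_cancel, add_zero, pow_zero, integral_const, smul_eq_mul, mul_one] at h8 h0
  have h80 : halfGaussianMoment 8 = 105 / 16 * halfGaussianMoment 0 := by
    have := halfGaussianMoment_add_eight 0
    norm_num at this
    exact this
  rw [halfGaussianMoment_add_eight, h80] at h8
  have key : (∫ u, ⟪e, (u : E)⟫_ℝ ^ 8 ∂(volume : Measure E).toSphere) *
      (((m : ℝ) + 1) * (m + 3) * (m + 5) * (m + 7)) =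
      105 * (volume : Measure E).toSphere.real Set.univ := by
    apply mul_right_cancel₀ hK.ne'
    linear_combination 16 * h8 - 105 * h0
  push_cast
  rw [show (m : ℝ) + 1 + 2 = m + 3 by ring, show (m : ℝ) + 1 + 4 = m + 5 by ring,
    show (m : ℝ) + 1 + 6 = m + 7 by ring]
  field_simp
  linear_combination key

/-- Polarization: `x⁴ y⁴` as a linear combination of eighth powers of linear forms. -/
lemma pow_four_mul_pow_four_eq (x y : ℝ) :
    x ^ 4 * y ^ 4 = 68 / 5040 * ((x + y) ^ 8 + (x - y) ^ 8)
      - 1 / 5040 * ((x + 2 * y) ^ 8 + (x - 2 * y) ^ 8 + (2 * x + y) ^ 8 + (2 * x - y) ^ 8)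
      + 378 / 5040 * (x ^ 8 + y ^ 8) := by
  ring

lemma integral_toSphere_inner_pow_four_mul_pow_four {E : Type*} [NormedAddCommGroup E]
    [InnerProductSpace ℝ E] [FiniteDimensional ℝ E] [Nontrivial E] [MeasurableSpace E]
    [BorelSpace E] {b c : E} (hb : ‖b‖ = 1) (hc : ‖c‖ = 1) :
    ∫ u, ⟪b, (u : E)⟫_ℝ ^ 4 * ⟪c, (u : E)⟫_ℝ ^ 4 ∂(volume : Measure E).toSphere =
      (24 * ⟪b, c⟫_ℝ ^ 4 + 72 * ⟪b, c⟫_ℝ ^ 2 + 9) /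
        ((Module.finrank ℝ E : ℝ) * (Module.finrank ℝ E + 2) * (Module.finrank ℝ E + 4) *
          (Module.finrank ℝ E + 6)) * (volume : Measure E).toSphere.real Set.univ := by
  have hint (v : E) :
      Integrable (fun u : Metric.sphere (0 : E) 1 => ⟪v, (u : E)⟫_ℝ ^ 8)
        (volume : Measure E).toSphere :=
    (by fun_prop : Continuous fun u : Metric.sphere (0 : E) 1 =>
      ⟪v, (u : E)⟫_ℝ ^ 8).integrable_of_hasCompactSupport (.of_compactSpace _)
  have hnorm (s t : ℝ) :
      ‖s • b + t • c‖ ^ 8 = (s ^ 2 + 2 * s * t * ⟪b, c⟫_ℝ + t ^ 2) ^ 4 := by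
    have h : ‖s • b + t • c‖ ^ 2 = s ^ 2 + 2 * s * t * ⟪b, c⟫_ℝ + t ^ 2 := by
      rw [norm_add_sq_real, norm_smul, norm_smul, hb, hc, real_inner_smul_left,
        real_inner_smul_right, mul_one, mul_one, norm_eq_abs, norm_eq_abs, sq_abs, sq_abs]
      ring
    rw [← h]
    ring
  have hpol (u : E) : ⟪b, u⟫_ℝ ^ 4 * ⟪c, u⟫_ℝ ^ 4 =
      68 / 5040 * (⟪(1 : ℝ) • b + (1 : ℝ) • c, u⟫_ℝ ^ 8 + ⟪(1 : ℝ) • b + (-1 : ℝ) • c, u⟫_ℝ ^ 8)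
      - 1 / 5040 * (⟪(1 : ℝ) • b + (2 : ℝ) • c, u⟫_ℝ ^ 8 + ⟪(1 : ℝ) • b + (-2 : ℝ) • c, u⟫_ℝ ^ 8
        + ⟪(2 : ℝ) • b + (1 : ℝ) • c, u⟫_ℝ ^ 8 + ⟪(2 : ℝ) • b + (-1 : ℝ) • c, u⟫_ℝ ^ 8)
      + 378 / 5040 * (⟪b, u⟫_ℝ ^ 8 + ⟪c, u⟫_ℝ ^ 8) := by
    simp only [inner_add_left, real_inner_smul_left]
    rw [pow_four_mul_pow_four_eq]
    ring
  simp_rw [hpol]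
  rw [integral_add (by fun_prop) (by fun_prop), integral_sub (by fun_prop) (by fun_prop)]
  simp only [integral_const_mul]
  rw [integral_add (hint _) (hint _), integral_add (hint _) (hint _),
    integral_add (by fun_prop) (hint _), integral_add (by fun_prop) (hint _),
    integral_add (hint _) (hint _)]
  simp only [integral_toSphere_inner_pow_eight, hnorm, hb, hc]
  ring

/-- Mixed moment formula for projections of a uniform random vector on the sphere. -/
theorem eta_four (d : ℕ) (hd : 2 ≤ d)
    (b c : Metric.sphere (0 : EuclideanSpace ℝ (Fin d)) 1) :
    unifExp d (fun u => ⟪(b : EuclideanSpace ℝ (Fin d)), (u : EuclideanSpace ℝ (Fin d))⟫_ℝ ^ 4 * ⟪(c : EuclideanSpace ℝ (Fin d)), (u : EuclideanSpace ℝ (Fin d))⟫_ℝ ^ 4)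
      = (24 * ⟪(b : EuclideanSpace ℝ (Fin d)), (c : EuclideanSpace ℝ (Fin d))⟫_ℝ ^ 4 + 72 * ⟪(b : EuclideanSpace ℝ (Fin d)), (c : EuclideanSpace ℝ (Fin d))⟫_ℝ ^ 2 + 9) / ((d : ℝ) * ((d : ℝ) + 2) * ((d : ℝ) + 4) * ((d : ℝ) + 6)) := by
  have : Nonempty (Fin d) := ⟨⟨0, by omega⟩⟩
  have hS : (volume : Measure (EuclideanSpace ℝ (Fin d))).toSphere.real Set.univ ≠ 0 := by
    rw [measureReal_ne_zero_iff, Measure.measure_univ_ne_zero]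
    exact Measure.toSphere_ne_zero _
  rw [unifExp, sphereMeasure, integral_toSphere_inner_pow_four_mul_pow_four
    (norm_eq_of_mem_sphere b) (norm_eq_of_mem_sphere c), ← Measure.real,
    finrank_euclideanSpace_fin]
  field_simp
end

section
/- Let U be uniformly distributed on S^{d-1}. Then for all b, c ∈ S^{d-1}, E[(b·U)⁵(c·U)⁵] = (120(b·c)⁵ + 600(b·c)³ + 225(b·c)) / (d(d+2)(d+4)(d+6)(d+8)). -/
open MeasureTheory Real
open scoped InnerProductSpace

/-- The half-line Gaussian moment `∫₀^∞ rⁿ e^{-r²} dr`. -/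
noncomputable def radialMoment (n : ℕ) : ℝ :=
  ∫ r in Set.Ioi (0 : ℝ), r ^ n * exp (-r ^ 2)

lemma radialMoment_eq_Gamma (n : ℕ) : radialMoment n = 1 / 2 * Gamma (((n : ℝ) + 1) / 2) := by
  rw [← integral_rpow_mul_exp_neg_rpow (by norm_num) (by linarith [n.cast_nonneg (α := ℝ)])]
  simp [radialMoment, rpow_natCast]

lemma radialMoment_pos (n : ℕ) : 0 < radialMoment n := by
  rw [radialMoment_eq_Gamma]
  have := Gamma_pos_of_pos (show (0 : ℝ) < ((n : ℝ) + 1) / 2 by positivity)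
  positivity

lemma radialMoment_add_two (n : ℕ) :
    radialMoment (n + 2) = ((n : ℝ) + 1) / 2 * radialMoment n := by
  rw [radialMoment_eq_Gamma, radialMoment_eq_Gamma,
    show (((n + 2 : ℕ) : ℝ) + 1) / 2 = ((n : ℝ) + 1) / 2 + 1 by push_cast; ring,
    Gamma_add_one (by positivity)]
  ring

lemma radialMoment_add_ten (n : ℕ) :
    radialMoment (n + 10) =
      ((n : ℝ) + 1) * (n + 3) * (n + 5) * (n + 7) * (n + 9) / 32 * radialMoment n := by
  rw [radialMoment_add_two (n + 8), radialMoment_add_two (n + 6), radialMoment_add_two (n + 4),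
    radialMoment_add_two (n + 2), radialMoment_add_two n]
  push_cast
  ring

lemma integral_pow_mul_exp_neg_sq_of_even {n : ℕ} (hn : Even n) :
    ∫ x : ℝ, x ^ n * exp (-x ^ 2) = 2 * radialMoment n := by
  rw [radialMoment, ← integral_comp_abs]
  simp [hn.pow_abs]

/-- Polar coordinates for a Gaussian-weighted homogeneous function. -/
lemma integral_homogeneous_mul_exp_neg_norm_sq {E : Type*} [NormedAddCommGroup E]
    [NormedSpace ℝ E] [FiniteDimensional ℝ E] [Nontrivial E] [MeasurableSpace E] [BorelSpace E]
    (μ : Measure E) [μ.IsAddHaarMeasure] {g : E → ℝ} {k : ℕ}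
    (hg : ∀ (r : ℝ) (x : E), g (r • x) = r ^ k * g x) :
    ∫ x, g x * exp (-‖x‖ ^ 2) ∂μ =
      (∫ u, g u ∂μ.toSphere) * radialMoment (Module.finrank ℝ E - 1 + k) :=
  calc
    ∫ x, g x * exp (-‖x‖ ^ 2) ∂μ
      = ∫ x : ({(0)}ᶜ : Set E), g x * exp (-‖x.1‖ ^ 2) ∂(μ.comap (↑)) := by
      rw [integral_subtype_comap (measurableSet_singleton _).compl
        fun x ↦ g x * exp (-‖x‖ ^ 2), restrict_compl_singleton]
    _ = ∫ p, g p.1 * ((p.2 : ℝ) ^ k * exp (-(p.2 : ℝ) ^ 2))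
          ∂μ.toSphere.prod (.volumeIoiPow (Module.finrank ℝ E - 1)) := by
      rw [← μ.measurePreserving_homeomorphUnitSphereProd.integral_comp
        (Homeomorph.measurableEmbedding _)]
      refine integral_congr_ae (.of_forall fun x ↦ ?_)
      have hx : ‖x.1‖ ≠ 0 := norm_ne_zero_iff.2 x.2
      simp only [homeomorphUnitSphereProd_apply_snd_coe, homeomorphUnitSphereProd_apply_fst_coe,
        hg, inv_pow]
      field_simp
    _ = (∫ u, g u ∂μ.toSphere) * ∫ r : Set.Ioi (0 : ℝ), (r : ℝ) ^ k * exp (-(r : ℝ) ^ 2)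
          ∂.volumeIoiPow (Module.finrank ℝ E - 1) :=
      integral_prod_mul (fun u : Metric.sphere (0 : E) 1 ↦ g u)
        fun r : Set.Ioi (0 : ℝ) ↦ (r : ℝ) ^ k * exp (-(r : ℝ) ^ 2)
    _ = _ := by
      simp only [Measure.volumeIoiPow, ENNReal.ofReal]
      rw [integral_withDensity_eq_integral_smul, integral_subtype_comap measurableSet_Ioi
          fun a : ℝ ↦ Real.toNNReal (a ^ (Module.finrank ℝ E - 1)) • (a ^ k * exp (-a ^ 2)),
        radialMoment, setIntegral_congr_fun measurableSet_Ioi fun x hx ↦ ?_]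
      · rw [NNReal.smul_def, Real.coe_toNNReal _ (pow_nonneg hx.out.le _), smul_eq_mul, pow_add,
          mul_assoc]
      · exact (measurable_subtype_coe.pow_const _).real_toNNReal

lemma integral_inner_pow_eq_of_norm_eq {E : Type*} [NormedAddCommGroup E]
    [InnerProductSpace ℝ E] [FiniteDimensional ℝ E] [MeasurableSpace E] [BorelSpace E]
    {v w : E} (h : ‖v‖ = ‖w‖) (n : ℕ) :
    ∫ x : E, ⟪v, x⟫_ℝ ^ n * exp (-‖x‖ ^ 2) = ∫ x : E, ⟪w, x⟫_ℝ ^ n * exp (-‖x‖ ^ 2) := by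
  let ρ : E ≃ₗᵢ[ℝ] E := (ℝ ∙ (v - w))ᗮ.reflection
  have hρ : ρ v = w := Submodule.reflection_sub h
  rw [← ρ.measurePreserving.integral_comp ρ.toHomeomorph.measurableEmbedding
    (fun x ↦ ⟪w, x⟫_ℝ ^ n * exp (-‖x‖ ^ 2)), ← hρ]
  simp

lemma integral_coord_pow_mul_exp_neg_norm_sq {d : ℕ} (i : Fin d) {n : ℕ} (hn : Even n) :
    ∫ x : EuclideanSpace ℝ (Fin d), x i ^ n * exp (-‖x‖ ^ 2) =
      2 * radialMoment n * (2 * radialMoment 0) ^ (d - 1) := by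
  have hprod (x : Fin d → ℝ) : x i ^ n * exp (-∑ j, x j ^ 2) =
      ∏ j, x j ^ (if j = i then n else 0) * exp (-x j ^ 2) := by
    rw [Finset.prod_mul_distrib, ← exp_sum, Finset.sum_neg_distrib]
    simp [pow_ite, Finset.prod_ite_eq']
  rw [← (PiLp.volume_preserving_toLp (Fin d)).integral_comp
    (MeasurableEquiv.toLp 2 (Fin d → ℝ)).measurableEmbedding]
  simp only [EuclideanSpace.real_norm_sq_eq, hprod]
  rw [integral_fintype_prod_volume_eq_prod
    (fun j (t : ℝ) ↦ t ^ (if j = i then n else 0) * exp (-t ^ 2)),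
    ← Finset.mul_prod_erase _ _ (Finset.mem_univ i), if_pos rfl,
    integral_pow_mul_exp_neg_sq_of_even hn,
    Finset.prod_congr rfl fun j hj ↦ by
      rw [if_neg (Finset.ne_of_mem_erase hj), integral_pow_mul_exp_neg_sq_of_even Even.zero]]
  simp

lemma integral_inner_pow_ten {d : ℕ} (hd : 0 < d) (v : EuclideanSpace ℝ (Fin d)) :
    ∫ x : EuclideanSpace ℝ (Fin d), ⟪v, x⟫_ℝ ^ 10 * exp (-‖x‖ ^ 2) =
      945 / 32 * ‖v‖ ^ 10 * ∫ x : EuclideanSpace ℝ (Fin d), exp (-‖x‖ ^ 2) := by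
  let i : Fin d := ⟨0, hd⟩
  have h0 := integral_coord_pow_mul_exp_neg_norm_sq i (n := 0) Even.zero
  simp only [pow_zero, one_mul] at h0
  rw [integral_inner_pow_eq_of_norm_eq (w := EuclideanSpace.single i ‖v‖) (by simp)]
  simp only [EuclideanSpace.inner_single_left, mul_pow, mul_assoc, integral_const_mul,
    integral_coord_pow_mul_exp_neg_norm_sq i (n := 10) (by decide), h0,
    radialMoment_add_ten 0]
  simp
  ring

/-- The tenth moment of a one-dimensional projection of a uniform vector on the sphere. -/
lemma unifExp_inner_pow_ten {d : ℕ} (hd : 0 < d) (v : EuclideanSpace ℝ (Fin d)) :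
    unifExp d (fun u ↦ ⟪v, (u : EuclideanSpace ℝ (Fin d))⟫_ℝ ^ 10) =
      945 * ‖v‖ ^ 10 / ((d : ℝ) * (d + 2) * (d + 4) * (d + 6) * (d + 8)) := by
  obtain ⟨m, rfl⟩ : ∃ m, d = m + 1 := ⟨d - 1, by omega⟩
  have hmass := integral_homogeneous_mul_exp_neg_norm_sq
    (volume : Measure (EuclideanSpace ℝ (Fin (m + 1)))) (g := fun _ ↦ 1) (k := 0) (by simp)
  have hmom := integral_homogeneous_mul_exp_neg_norm_sq
    (volume : Measure (EuclideanSpace ℝ (Fin (m + 1)))) (g := fun x ↦ ⟪v, x⟫_ℝ ^ 10) (k := 10)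
    (by simp [inner_smul_right, mul_pow])
  simp only [one_mul, integral_const, smul_eq_mul, mul_one, finrank_euclideanSpace_fin,
    Nat.add_sub_cancel, add_zero] at hmass hmom
  rw [integral_inner_pow_ten hd, hmass, radialMoment_add_ten] at hmom
  have hR := (radialMoment_pos m).ne'
  have hS : (sphereMeasure (m + 1)).real Set.univ ≠ 0 := by
    have : sphereMeasure (m + 1) ≠ 0 := Measure.toSphere_ne_zero _
    have : IsFiniteMeasure (sphereMeasure (m + 1)) := by unfold sphereMeasure; infer_instance
    simpa [Measure.real, ENNReal.toReal_eq_zero_iff]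
  change ((sphereMeasure (m + 1)).real Set.univ)⁻¹ * _ = _
  change _ * _ * ((sphereMeasure (m + 1)).real Set.univ * _) =
    (∫ u, _ ∂sphereMeasure (m + 1)) * _ at hmom
  rw [inv_mul_eq_iff_eq_mul₀ hS, mul_div_assoc', eq_div_iff (by positivity)]
  apply mul_right_cancel₀ hR
  push_cast
  linear_combination -32 * hmom

lemma pow_five_mul_pow_five_eq (x y : ℝ) :
    x ^ 5 * y ^ 5 =
      323 / 1451520 * ((x + 1 * y) ^ 10 - (x + (-1) * y) ^ 10)
      - 13 / 60480 * ((x + 2 * y) ^ 10 - (x + (-2) * y) ^ 10)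
      + 29 / 322560 * ((x + 3 * y) ^ 10 - (x + (-3) * y) ^ 10)
      - 19 / 1088640 * ((x + 4 * y) ^ 10 - (x + (-4) * y) ^ 10)
      + 13 / 8709120 * ((x + 5 * y) ^ 10 - (x + (-5) * y) ^ 10) := by
  ring

/-- Mixed moment formula for projections of a uniform random vector on the sphere. -/
theorem eta_five (d : ℕ) (hd : 2 ≤ d)
    (b c : Metric.sphere (0 : EuclideanSpace ℝ (Fin d)) 1) :
    unifExp d (fun u => ⟪(b : EuclideanSpace ℝ (Fin d)), (u : EuclideanSpace ℝ (Fin d))⟫_ℝ ^ 5 * ⟪(c : EuclideanSpace ℝ (Fin d)), (u : EuclideanSpace ℝ (Fin d))⟫_ℝ ^ 5)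
      = (120 * ⟪(b : EuclideanSpace ℝ (Fin d)), (c : EuclideanSpace ℝ (Fin d))⟫_ℝ ^ 5 + 600 * ⟪(b : EuclideanSpace ℝ (Fin d)), (c : EuclideanSpace ℝ (Fin d))⟫_ℝ ^ 3 + 225 * ⟪(b : EuclideanSpace ℝ (Fin d)), (c : EuclideanSpace ℝ (Fin d))⟫_ℝ) / ((d : ℝ) * ((d : ℝ) + 2) * ((d : ℝ) + 4) * ((d : ℝ) + 6) * ((d : ℝ) + 8)) := by
  have hfin : IsFiniteMeasure (sphereMeasure d) := by unfold sphereMeasure; infer_instance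
  have hpow_int (t : ℝ) : Integrable (fun u : Metric.sphere (0 : EuclideanSpace ℝ (Fin d)) 1 ↦
      (⟪(b : EuclideanSpace ℝ (Fin d)), (u : EuclideanSpace ℝ (Fin d))⟫_ℝ
        + t * ⟪(c : EuclideanSpace ℝ (Fin d)), (u : EuclideanSpace ℝ (Fin d))⟫_ℝ) ^ 10)
      (sphereMeasure d) :=
    Continuous.integrable_of_hasCompactSupport (by fun_prop)
      (HasCompactSupport.of_compactSpace _)
  have hmom (t : ℝ) : unifExp d (fun u ↦
      (⟪(b : EuclideanSpace ℝ (Fin d)), (u : EuclideanSpace ℝ (Fin d))⟫_ℝ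
        + t * ⟪(c : EuclideanSpace ℝ (Fin d)), (u : EuclideanSpace ℝ (Fin d))⟫_ℝ) ^ 10) =
      945 * (1 + 2 * t * ⟪(b : EuclideanSpace ℝ (Fin d)), (c : EuclideanSpace ℝ (Fin d))⟫_ℝ
        + t ^ 2) ^ 5 / ((d : ℝ) * (d + 2) * (d + 4) * (d + 6) * (d + 8)) := by
    have h := unifExp_inner_pow_ten (by omega : 0 < d)
      ((b : EuclideanSpace ℝ (Fin d)) + t • (c : EuclideanSpace ℝ (Fin d)))
    rw [show ∀ a : ℝ, a ^ 10 = (a ^ 2) ^ 5 by intro a; ring, norm_add_sq_real] at h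
    simpa [inner_add_left, real_inner_smul_left, real_inner_smul_right, norm_smul,
      mul_assoc] using h
  unfold unifExp at hmom ⊢
  simp only [pow_five_mul_pow_five_eq]
  rw [integral_add (by fun_prop) (by fun_prop), integral_sub (by fun_prop) (by fun_prop),
    integral_add (by fun_prop) (by fun_prop), integral_sub (by fun_prop) (by fun_prop)]
  simp only [integral_const_mul, integral_sub (hpow_int _) (hpow_int _)]
  linear_combination
    323 / 1451520 * (hmom 1 - hmom (-1)) - 13 / 60480 * (hmom 2 - hmom (-2))
    + 29 / 322560 * (hmom 3 - hmom (-3)) - 19 / 1088640 * (hmom 4 - hmom (-4))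
    + 13 / 8709120 * (hmom 5 - hmom (-5))
end

section
/- Let ρ_2(ω,x) = E[(ω·U)²(x·U)²] − 1/d² (where U is uniform on S^{d-1} and ψ_d(2) = 1/d). Then for all indices i ≠ j in {1,…,d} the second-order spherical harmonic φ(u) = u_i u_j is an eigenfunction of the integral operator K_2 with eigenvalue (2/(d(d+2)))²: for every x ∈ S^{d-1}, (1/|S^{d-1}|) ∫_{S^{d-1}} ρ_2(ω, x) ω_i ω_j dσ(ω) = (2/(d(d+2)))² · x_i x_j. -/
open MeasureTheory Real
open scoped InnerProductSpace

/-- The kernel `ρ_2(ω,x) = E[(ω⬝U)²(x⬝U)²] − 1/d²` for `U` uniform on the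
sphere (here `ψ_d(2) = 1/d`). -/
noncomputable def rhoTwo (d : ℕ)
    (w x : Metric.sphere (0 : EuclideanSpace ℝ (Fin d)) 1) : ℝ :=
  unifExp d (fun u =>
      ⟪(w : EuclideanSpace ℝ (Fin d)), (u : EuclideanSpace ℝ (Fin d))⟫_ℝ ^ 2 *
        ⟪(x : EuclideanSpace ℝ (Fin d)), (u : EuclideanSpace ℝ (Fin d))⟫_ℝ ^ 2)
    - 1 / (d : ℝ) ^ 2

local notation "E" d => EuclideanSpace ℝ (Fin d)
local notation "S" d => Metric.sphere (0 : EuclideanSpace ℝ (Fin d)) 1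

instance isFiniteMeasure_sphereMeasure (d : ℕ) : IsFiniteMeasure (sphereMeasure d) := by
  unfold sphereMeasure; infer_instance

theorem Continuous.integrable_sphereMeasure {d : ℕ} {g : (S d) → ℝ} (hg : Continuous g) :
    Integrable g (sphereMeasure d) :=
  hg.integrable_of_hasCompactSupport (HasCompactSupport.of_compactSpace g)

/-- The self-map of the unit sphere induced by a linear isometry equivalence. -/
noncomputable def sphereMap {d : ℕ} (L : (E d) ≃ₗᵢ[ℝ] (E d)) (u : S d) : S d :=
  ⟨L u, by simp⟩

theorem continuous_sphereMap {d : ℕ} (L : (E d) ≃ₗᵢ[ℝ] (E d)) : Continuous (sphereMap L) :=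
  (L.continuous.comp continuous_subtype_val).subtype_mk _

open scoped Pointwise in
theorem measurePreserving_sphereMap {d : ℕ} (L : (E d) ≃ₗᵢ[ℝ] (E d)) :
    MeasurePreserving (sphereMap L) (sphereMeasure d) (sphereMeasure d) := by
  refine ⟨(continuous_sphereMap L).measurable, ?_⟩
  ext s hs
  have hpre := (continuous_sphereMap L).measurable hs
  have hcone : Set.Ioo (0 : ℝ) 1 • ((↑) '' (sphereMap L ⁻¹' s) : Set (E d)) =
      L ⁻¹' (Set.Ioo (0 : ℝ) 1 • ((↑) '' s : Set (E d))) := by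
    ext y
    simp only [Set.mem_smul, Set.mem_preimage, Set.mem_image]
    constructor
    · rintro ⟨r, hr, _, ⟨u, hu, rfl⟩, rfl⟩
      exact ⟨r, hr, _, ⟨sphereMap L u, hu, rfl⟩, by simp [sphereMap]⟩
    · rintro ⟨r, hr, _, ⟨u, hu, rfl⟩, h⟩
      have hLu : sphereMap L (sphereMap L.symm u) = u := by
        ext1
        simp [sphereMap]
      refine ⟨r, hr, _, ⟨sphereMap L.symm u, by rwa [hLu], rfl⟩, ?_⟩
      apply L.injective
      simp [sphereMap, ← h]
  rw [Measure.map_apply (continuous_sphereMap L).measurable hs]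
  unfold sphereMeasure
  rw [Measure.toSphere_apply' _ hpre, Measure.toSphere_apply' _ hs, hcone]
  congr 1
  exact L.measurePreserving.measure_preimage_emb L.toHomeomorph.measurableEmbedding _

theorem unifExp_comp_sphereMap {d : ℕ} (L : (E d) ≃ₗᵢ[ℝ] (E d)) {g : (S d) → ℝ}
    (hg : Continuous g) : unifExp d (fun u => g (sphereMap L u)) = unifExp d g := by
  unfold unifExp
  congr 1
  have h := measurePreserving_sphereMap L
  conv_rhs => rw [← h.map_eq]
  rw [integral_map h.measurable.aemeasurable hg.aestronglyMeasurable]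

theorem unifExp_add {d : ℕ} {f g : (S d) → ℝ} (hf : Continuous f) (hg : Continuous g) :
    unifExp d (fun u => f u + g u) = unifExp d f + unifExp d g := by
  unfold unifExp
  rw [integral_add hf.integrable_sphereMeasure hg.integrable_sphereMeasure, mul_add]

theorem unifExp_const_mul {d : ℕ} (c : ℝ) (f : (S d) → ℝ) :
    unifExp d (fun u => c * f u) = c * unifExp d f := by
  unfold unifExp
  rw [integral_const_mul]
  ring

theorem unifExp_sum {d : ℕ} {ι : Type*} (s : Finset ι) {f : ι → (S d) → ℝ}
    (hf : ∀ k ∈ s, Continuous (f k)) :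
    unifExp d (fun u => ∑ k ∈ s, f k u) = ∑ k ∈ s, unifExp d (f k) := by
  unfold unifExp
  rw [integral_finsetSum _ fun k hk => (hf k hk).integrable_sphereMeasure, Finset.mul_sum]

theorem unifExp_one {d : ℕ} (hd : 0 < d) : unifExp d (fun _ => 1) = 1 := by
  have : Nonempty (Fin d) := ⟨⟨0, hd⟩⟩
  have h0 : (sphereMeasure d) Set.univ ≠ 0 := by
    rw [Ne, Measure.measure_univ_eq_zero]
    exact Measure.toSphere_ne_zero _
  have h1 : ((sphereMeasure d) Set.univ).toReal ≠ 0 :=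
    ENNReal.toReal_ne_zero.2 ⟨h0, measure_ne_top _ _⟩
  simp [unifExp, Measure.real, h1]

theorem unifExp_inner_pow_four_congr {d : ℕ} {v w : E d} (h : ‖v‖ = ‖w‖) :
    unifExp d (fun u => ⟪v, (u : E d)⟫_ℝ ^ 4) = unifExp d (fun u => ⟪w, (u : E d)⟫_ℝ ^ 4) := by
  set L := (ℝ ∙ (v - w))ᗮ.reflection
  have hL : L v = w := Submodule.reflection_sub h
  have hc : Continuous fun u : S d => ⟪w, (u : E d)⟫_ℝ ^ 4 := by fun_prop
  rw [← unifExp_comp_sphereMap L hc]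
  congr 1
  ext u
  rw [← hL]
  simp [sphereMap]

theorem exists_unifExp_inner_pow_four {d : ℕ} (hd : 0 < d) :
    ∃ A : ℝ, ∀ v : E d, unifExp d (fun u => ⟪v, (u : E d)⟫_ℝ ^ 4) = A * (‖v‖ ^ 2) ^ 2 := by
  let e : E d := EuclideanSpace.single ⟨0, hd⟩ 1
  refine ⟨unifExp d (fun u => ⟪e, (u : E d)⟫_ℝ ^ 4), fun v => ?_⟩
  have h : ‖v‖ = ‖‖v‖ • e‖ := by simp [e, norm_smul]
  rw [unifExp_inner_pow_four_congr h, mul_comm, ← unifExp_const_mul]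
  congr 1
  ext u
  rw [real_inner_smul_left]
  ring

theorem exists_unifExp_inner_sq_mul_inner_sq {d : ℕ} (hd : 0 < d) :
    ∃ C : ℝ, ∀ v w : E d, unifExp d (fun u => ⟪v, (u : E d)⟫_ℝ ^ 2 * ⟪w, (u : E d)⟫_ℝ ^ 2) =
      C * (‖v‖ ^ 2 * ‖w‖ ^ 2 + 2 * ⟪v, w⟫_ℝ ^ 2) := by
  obtain ⟨A, hA⟩ := exists_unifExp_inner_pow_four hd
  refine ⟨A / 3, fun v w => ?_⟩
  have hpol : unifExp d (fun u => ⟪v + w, (u : E d)⟫_ℝ ^ 4 + ⟪v - w, (u : E d)⟫_ℝ ^ 4) =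
      unifExp d (fun u => 12 * (⟪v, (u : E d)⟫_ℝ ^ 2 * ⟪w, (u : E d)⟫_ℝ ^ 2) +
        (2 * ⟪v, (u : E d)⟫_ℝ ^ 4 + 2 * ⟪w, (u : E d)⟫_ℝ ^ 4)) := by
    congr 1
    ext u
    rw [inner_add_left, inner_sub_left]
    ring
  rw [unifExp_add (by fun_prop) (by fun_prop), unifExp_add (by fun_prop) (by fun_prop),
    unifExp_add (by fun_prop) (by fun_prop), unifExp_const_mul, unifExp_const_mul,
    unifExp_const_mul, hA, hA, hA, hA, norm_add_sq_real, norm_sub_sq_real] at hpol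
  linarith

theorem sum_inner_single_sq {d : ℕ} (v : E d) :
    ∑ k : Fin d, ⟪EuclideanSpace.single k (1 : ℝ), v⟫_ℝ ^ 2 = ‖v‖ ^ 2 := by
  simp [EuclideanSpace.real_norm_sq_eq, EuclideanSpace.inner_single_left]

theorem unifExp_inner_sq_of_fourth {d : ℕ} {C : ℝ}
    (hC : ∀ v w : E d, unifExp d (fun u => ⟪v, (u : E d)⟫_ℝ ^ 2 * ⟪w, (u : E d)⟫_ℝ ^ 2) =
      C * (‖v‖ ^ 2 * ‖w‖ ^ 2 + 2 * ⟪v, w⟫_ℝ ^ 2)) (v : E d) :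
    unifExp d (fun u => ⟪v, (u : E d)⟫_ℝ ^ 2) = C * (d + 2) * ‖v‖ ^ 2 := by
  have h : unifExp d (fun u => ⟪v, (u : E d)⟫_ℝ ^ 2) = unifExp d (fun u => ∑ k : Fin d,
      ⟪EuclideanSpace.single k (1 : ℝ), (u : E d)⟫_ℝ ^ 2 * ⟪v, (u : E d)⟫_ℝ ^ 2) := by
    congr 1
    ext u
    rw [← Finset.sum_mul, sum_inner_single_sq]
    simp
  rw [h, unifExp_sum _ fun k _ => by fun_prop]
  simp only [hC]
  rw [← Finset.mul_sum, Finset.sum_add_distrib, ← Finset.mul_sum, sum_inner_single_sq]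
  simp
  ring

theorem unifExp_inner_sq_mul_inner_sq {d : ℕ} (hd : 0 < d) (v w : E d) :
    unifExp d (fun u => ⟪v, (u : E d)⟫_ℝ ^ 2 * ⟪w, (u : E d)⟫_ℝ ^ 2) =
      1 / (d * (d + 2)) * (‖v‖ ^ 2 * ‖w‖ ^ 2 + 2 * ⟪v, w⟫_ℝ ^ 2) := by
  obtain ⟨C, hC⟩ := exists_unifExp_inner_sq_mul_inner_sq hd
  have h : unifExp d (fun _ => 1) = unifExp d (fun u => ∑ k : Fin d,
      ⟪EuclideanSpace.single k (1 : ℝ), (u : E d)⟫_ℝ ^ 2) := by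
    congr 1
    ext u
    rw [sum_inner_single_sq]
    simp
  rw [unifExp_one hd, unifExp_sum _ fun k _ => by fun_prop] at h
  simp only [unifExp_inner_sq_of_fourth hC] at h
  have hd' : (0 : ℝ) < d := by exact_mod_cast hd
  have hCd : C = 1 / (d * (d + 2)) := by
    rw [eq_div_iff (by positivity)]
    simp at h
    linarith
  rw [hC, hCd]

theorem unifExp_inner_sq {d : ℕ} (hd : 0 < d) (v : E d) :
    unifExp d (fun u => ⟪v, (u : E d)⟫_ℝ ^ 2) = 1 / d * ‖v‖ ^ 2 := by
  rw [unifExp_inner_sq_of_fourth (unifExp_inner_sq_mul_inner_sq hd)]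
  have hd' : (0 : ℝ) < d := by exact_mod_cast hd
  field_simp

theorem unifExp_inner_mul_inner {d : ℕ} (hd : 0 < d) (v w : E d) :
    unifExp d (fun u => ⟪v, (u : E d)⟫_ℝ * ⟪w, (u : E d)⟫_ℝ) = 1 / d * ⟪v, w⟫_ℝ := by
  have hpol : unifExp d (fun u => ⟪v + w, (u : E d)⟫_ℝ ^ 2) =
      unifExp d (fun u => 4 * (⟪v, (u : E d)⟫_ℝ * ⟪w, (u : E d)⟫_ℝ) +
        ⟪v - w, (u : E d)⟫_ℝ ^ 2) := by
    congr 1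
    ext u
    rw [inner_add_left, inner_sub_left]
    ring
  rw [unifExp_add (by fun_prop) (by fun_prop), unifExp_const_mul, unifExp_inner_sq hd,
    unifExp_inner_sq hd, norm_add_sq_real, norm_sub_sq_real] at hpol
  linarith

theorem unifExp_inner_sq_mul_inner_mul_inner {d : ℕ} (hd : 0 < d) (x v w : E d) :
    unifExp d (fun u => ⟪x, (u : E d)⟫_ℝ ^ 2 * (⟪v, (u : E d)⟫_ℝ * ⟪w, (u : E d)⟫_ℝ)) =
      1 / (d * (d + 2)) * (‖x‖ ^ 2 * ⟪v, w⟫_ℝ + 2 * (⟪x, v⟫_ℝ * ⟪x, w⟫_ℝ)) := by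
  have hpol : unifExp d (fun u => ⟪x, (u : E d)⟫_ℝ ^ 2 * ⟪v + w, (u : E d)⟫_ℝ ^ 2) =
      unifExp d (fun u =>
        4 * (⟪x, (u : E d)⟫_ℝ ^ 2 * (⟪v, (u : E d)⟫_ℝ * ⟪w, (u : E d)⟫_ℝ)) +
        ⟪x, (u : E d)⟫_ℝ ^ 2 * ⟪v - w, (u : E d)⟫_ℝ ^ 2) := by
    congr 1
    ext u
    rw [inner_add_left, inner_sub_left]
    ring
  rw [unifExp_add (by fun_prop) (by fun_prop), unifExp_const_mul,
    unifExp_inner_sq_mul_inner_sq hd, unifExp_inner_sq_mul_inner_sq hd, norm_add_sq_real,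
    norm_sub_sq_real, inner_add_right, inner_sub_right] at hpol
  linarith

theorem rhoTwo_eq {d : ℕ} (hd : 0 < d) (w x : S d) :
    rhoTwo d w x =
      1 / (d * (d + 2)) * (1 + 2 * ⟪(x : E d), (w : E d)⟫_ℝ ^ 2) - 1 / (d : ℝ) ^ 2 := by
  rw [rhoTwo, unifExp_inner_sq_mul_inner_sq hd, real_inner_comm]
  simp

/-- For `i ≠ j`, the second-order spherical harmonic `u ↦ u_i u_j` is an
eigenfunction of the integral operator `K_2` with eigenvalue `(2/(d(d+2)))²`:
`(1/|S^{d-1}|) ∫ ρ_2(ω,x) ω_i ω_j dσ(ω) = (2/(d(d+2)))² x_i x_j`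
for every `x ∈ S^{d-1}`. -/
theorem secondOrderHarmonic_eigenfunction (d : ℕ) (hd : 2 ≤ d)
    (i j : Fin d) (hij : i ≠ j)
    (x : Metric.sphere (0 : EuclideanSpace ℝ (Fin d)) 1) :
    ((sphereMeasure d) Set.univ).toReal⁻¹ *
        ∫ ω, rhoTwo d ω x *
            ((ω : EuclideanSpace ℝ (Fin d)) i * (ω : EuclideanSpace ℝ (Fin d)) j)
          ∂(sphereMeasure d)
      = (2 / ((d : ℝ) * ((d : ℝ) + 2))) ^ 2 *
          ((x : EuclideanSpace ℝ (Fin d)) i * (x : EuclideanSpace ℝ (Fin d)) j) := by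
  have hd0 : 0 < d := by omega
  let e (k : Fin d) : E d := EuclideanSpace.single k 1
  have he (k : Fin d) (u : E d) : ⟪e k, u⟫_ℝ = u k := by simp [e, EuclideanSpace.inner_single_left]
  have hxe (k : Fin d) : ⟪(x : E d), e k⟫_ℝ = (x : E d) k := by rw [real_inner_comm, he]
  have hee : ⟪e i, e j⟫_ℝ = 0 := by simp [he, e, hij]
  have hexpand : unifExp d (fun ω => rhoTwo d ω x * ((ω : E d) i * (ω : E d) j)) =
      unifExp d (fun ω =>
        (1 / ((d : ℝ) * (d + 2)) - 1 / (d : ℝ) ^ 2) * (⟪e i, (ω : E d)⟫_ℝ * ⟪e j, (ω : E d)⟫_ℝ) +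
        2 / ((d : ℝ) * (d + 2)) *
          (⟪(x : E d), (ω : E d)⟫_ℝ ^ 2 * (⟪e i, (ω : E d)⟫_ℝ * ⟪e j, (ω : E d)⟫_ℝ))) := by
    congr 1
    ext ω
    rw [rhoTwo_eq hd0, he, he]
    ring
  change unifExp d (fun ω => rhoTwo d ω x * ((ω : E d) i * (ω : E d) j)) = _
  rw [hexpand, unifExp_add (by fun_prop) (by fun_prop), unifExp_const_mul, unifExp_const_mul,
    unifExp_inner_mul_inner hd0, unifExp_inner_sq_mul_inner_mul_inner hd0, hee, hxe, hxe]
  ring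
end

section
/- Fix θ ∈ S^{d-1}. For κ > 0 define the von Mises–Fisher normalizing constant a(κ) = ∫_{S^{d-1}} exp(κ θ·x) dσ(x), the Kullback–Leibler divergence of the vMF(θ,κ) law from the uniform law KL(κ) = (κ/a(κ)) ∫_{S^{d-1}} (θ·x) exp(κ θ·x) dσ(x) − log(a(κ)/|S^{d-1}|), and γ_κ(b) = (1/a(κ)) ∫_{S^{d-1}} (b·x) exp(κ θ·x) dσ(x) for b ∈ S^{d-1} (the mean projection shift for β = 1). Then lim_{κ → 0⁺} ( sup_{b ∈ S^{d-1}} γ_κ(b)² ) / ( 2 KL(κ) ) = 1/d; consequently the statistic √(T_{n,1}) (the Rayleigh test) is locally asymptotically optimal in the Bahadur sense against von Mises–Fisher alternatives. -/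
open MeasureTheory Real Filter
open scoped InnerProductSpace Topology

/-- The von Mises–Fisher normalizing constant
`a(κ) = ∫_{S^{d-1}} exp(κ θ⬝x) dσ(x)`. -/
noncomputable def vMFconst (d : ℕ) (θ : EuclideanSpace ℝ (Fin d)) (κ : ℝ) : ℝ :=
  ∫ x, Real.exp (κ * ⟪θ, (x : EuclideanSpace ℝ (Fin d))⟫_ℝ) ∂(sphereMeasure d)

/-- The Kullback–Leibler divergence of `vMF(θ,κ)` from the uniform law:
`KL(κ) = (κ/a(κ)) ∫ (θ⬝x) exp(κ θ⬝x) dσ(x) − log(a(κ)/|S^{d-1}|)`. -/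
noncomputable def vMFKL (d : ℕ) (θ : EuclideanSpace ℝ (Fin d)) (κ : ℝ) : ℝ :=
  κ / vMFconst d θ κ *
      ∫ x, ⟪θ, (x : EuclideanSpace ℝ (Fin d))⟫_ℝ *
        Real.exp (κ * ⟪θ, (x : EuclideanSpace ℝ (Fin d))⟫_ℝ) ∂(sphereMeasure d)
    - Real.log (vMFconst d θ κ / ((sphereMeasure d) Set.univ).toReal)

/-- The mean projection shift for `β = 1`:
`γ_κ(b) = (1/a(κ)) ∫ (b⬝x) exp(κ θ⬝x) dσ(x)`. -/
noncomputable def vMFgamma (d : ℕ) (θ : EuclideanSpace ℝ (Fin d)) (κ : ℝ)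
    (b : Metric.sphere (0 : EuclideanSpace ℝ (Fin d)) 1) : ℝ :=
  (vMFconst d θ κ)⁻¹ *
    ∫ x, ⟪(b : EuclideanSpace ℝ (Fin d)), (x : EuclideanSpace ℝ (Fin d))⟫_ℝ *
      Real.exp (κ * ⟪θ, (x : EuclideanSpace ℝ (Fin d))⟫_ℝ) ∂(sphereMeasure d)

section SphereIsometry

variable {E : Type*} [NormedAddCommGroup E] [InnerProductSpace ℝ E]

/-- The self-homeomorphism of the unit sphere induced by a linear isometry. -/
noncomputable def LinearIsometryEquiv.unitSphereHomeomorph (R : E ≃ₗᵢ[ℝ] E) :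
    Metric.sphere (0 : E) 1 ≃ₜ Metric.sphere (0 : E) 1 :=
  R.toHomeomorph.subtype fun x => by simp

@[simp]
theorem LinearIsometryEquiv.coe_unitSphereHomeomorph (R : E ≃ₗᵢ[ℝ] E)
    (x : Metric.sphere (0 : E) 1) : (R.unitSphereHomeomorph x : E) = R x := rfl

variable [FiniteDimensional ℝ E] [MeasurableSpace E] [BorelSpace E]

open scoped Pointwise in
/-- The surface measure on the unit sphere is invariant under linear isometries. -/
theorem LinearIsometryEquiv.measurePreserving_unitSphereHomeomorph (R : E ≃ₗᵢ[ℝ] E) :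
    MeasurePreserving R.unitSphereHomeomorph
      (volume : Measure E).toSphere (volume : Measure E).toSphere := by
  refine ⟨R.unitSphereHomeomorph.continuous.measurable, ?_⟩
  ext s hs
  have hm := R.unitSphereHomeomorph.continuous.measurable
  rw [Measure.map_apply hm hs, Measure.toSphere_apply' _ (hm hs), Measure.toSphere_apply' _ hs]
  congr 1
  have hcone : Set.Ioo (0 : ℝ) 1 • (Subtype.val '' (R.unitSphereHomeomorph ⁻¹' s))
      = R ⁻¹' (Set.Ioo (0 : ℝ) 1 • (Subtype.val '' s)) := by
    ext y
    simp only [Set.mem_smul, Set.mem_preimage]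
    constructor
    · rintro ⟨r, hr, _, ⟨x, hx, rfl⟩, rfl⟩
      exact ⟨r, hr, _, ⟨_, hx, rfl⟩, by simp⟩
    · rintro ⟨r, hr, _, ⟨x, hx, rfl⟩, hy⟩
      refine ⟨r, hr, _, ⟨R.unitSphereHomeomorph.symm x, by simpa using hx, rfl⟩, ?_⟩
      apply R.injective
      rw [← hy, map_smul, ← R.coe_unitSphereHomeomorph, Homeomorph.apply_symm_apply]
  rw [hcone]
  exact R.measurePreserving.measure_preimage_equiv (f := R.toMeasurableEquiv) _

theorem LinearIsometryEquiv.integral_toSphere_comp (R : E ≃ₗᵢ[ℝ] E) (f : E → ℝ) :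
    ∫ x : Metric.sphere (0 : E) 1, f (R x) ∂(volume : Measure E).toSphere
      = ∫ x : Metric.sphere (0 : E) 1, f x ∂(volume : Measure E).toSphere :=
  R.measurePreserving_unitSphereHomeomorph.integral_comp
    R.unitSphereHomeomorph.measurableEmbedding fun x => f x

end SphereIsometry

section

variable {d : ℕ}

instance : IsFiniteMeasure (sphereMeasure d) := by
  unfold sphereMeasure; infer_instance

theorem Continuous.integrable_sphereMeasure_s19
    {f : Metric.sphere (0 : EuclideanSpace ℝ (Fin d)) 1 → ℝ} (hf : Continuous f) :
    Integrable f (sphereMeasure d) :=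
  hf.integrable_of_hasCompactSupport (HasCompactSupport.of_compactSpace f)

theorem sphereMeasure_real_univ_pos (hd : 0 < d) : 0 < (sphereMeasure d).real Set.univ := by
  have : Nonempty (Fin d) := ⟨⟨0, hd⟩⟩
  have : sphereMeasure d ≠ 0 := Measure.toSphere_ne_zero _
  have : NeZero (sphereMeasure d) := ⟨this⟩
  exact measureReal_univ_pos

theorem integral_inner_sphereMeasure (θ : EuclideanSpace ℝ (Fin d)) :
    ∫ x, ⟪θ, (x : EuclideanSpace ℝ (Fin d))⟫_ℝ ∂(sphereMeasure d) = 0 := by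
  have h := (LinearIsometryEquiv.neg ℝ (E := EuclideanSpace ℝ (Fin d))).integral_toSphere_comp
    fun x => ⟪θ, x⟫_ℝ
  simp only [LinearIsometryEquiv.coe_neg, inner_neg_right, integral_neg] at h
  unfold sphereMeasure
  linarith

/-- The second moment of the uniform law in a unit direction is `1 / d`. -/
theorem integral_inner_sq_sphereMeasure (hd : 0 < d) {θ : EuclideanSpace ℝ (Fin d)}
    (hθ : ‖θ‖ = 1) :
    ∫ x, ⟪θ, (x : EuclideanSpace ℝ (Fin d))⟫_ℝ ^ 2 ∂(sphereMeasure d)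
      = (sphereMeasure d).real Set.univ / d := by
  have hcoord (i : Fin d) :
      ∫ x, ⟪EuclideanSpace.basisFun (Fin d) ℝ i, (x : EuclideanSpace ℝ (Fin d))⟫_ℝ ^ 2
          ∂(sphereMeasure d)
        = ∫ x, ⟪θ, (x : EuclideanSpace ℝ (Fin d))⟫_ℝ ^ 2 ∂(sphereMeasure d) := by
    set e := EuclideanSpace.basisFun (Fin d) ℝ i
    have he : ‖θ‖ = ‖e‖ := by simp [hθ, e]
    have h := ((ℝ ∙ (θ - e))ᗮ.reflection).integral_toSphere_comp fun x => ⟪e, x⟫_ℝ ^ 2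
    rw [sphereMeasure, ← h]
    congr 1 with x
    have hinner := ((ℝ ∙ (θ - e))ᗮ.reflection).inner_map_map θ x
    rw [Submodule.reflection_sub he] at hinner
    rw [hinner]
  have hsum : ∑ i : Fin d,
      ∫ x, ⟪EuclideanSpace.basisFun (Fin d) ℝ i, (x : EuclideanSpace ℝ (Fin d))⟫_ℝ ^ 2
        ∂(sphereMeasure d) = (sphereMeasure d).real Set.univ := by
    rw [← integral_finsetSum _ fun i _ =>
      Continuous.integrable_sphereMeasure_s19 (by fun_prop)]
    simp only [OrthonormalBasis.sum_sq_inner_right, norm_eq_of_mem_sphere]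
    simp
  rw [Finset.sum_congr rfl fun i _ => hcoord i] at hsum
  have : (d : ℝ) ≠ 0 := by positivity
  rw [← hsum]
  simp
  field_simp

/-- The mean of a rotationally symmetric law about `θ` points in the direction `θ`. -/
theorem integral_inner_mul_comp_inner {θ : EuclideanSpace ℝ (Fin d)} (hθ : ‖θ‖ = 1)
    (b : EuclideanSpace ℝ (Fin d)) {g : ℝ → ℝ} (hg : Continuous g) :
    ∫ x, ⟪b, (x : EuclideanSpace ℝ (Fin d))⟫_ℝ *
        g ⟪θ, (x : EuclideanSpace ℝ (Fin d))⟫_ℝ ∂(sphereMeasure d)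
      = ⟪θ, b⟫_ℝ * ∫ x, ⟪θ, (x : EuclideanSpace ℝ (Fin d))⟫_ℝ *
        g ⟪θ, (x : EuclideanSpace ℝ (Fin d))⟫_ℝ ∂(sphereMeasure d) := by
  have h := ((ℝ ∙ θ).reflection).integral_toSphere_comp fun x => ⟪b, x⟫_ℝ * g ⟪θ, x⟫_ℝ
  have hpoint (x : EuclideanSpace ℝ (Fin d)) :
      ⟪b, (ℝ ∙ θ).reflection x⟫_ℝ * g ⟪θ, (ℝ ∙ θ).reflection x⟫_ℝ
        = 2 * ⟪θ, b⟫_ℝ * (⟪θ, x⟫_ℝ * g ⟪θ, x⟫_ℝ) - ⟪b, x⟫_ℝ * g ⟪θ, x⟫_ℝ := by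
    have hx : (ℝ ∙ θ).reflection x = (2 * ⟪θ, x⟫_ℝ) • θ - x := by
      rw [Submodule.reflection_singleton_apply]
      simp [hθ, two_smul, two_mul, add_smul]
    rw [hx, inner_sub_right, inner_sub_right, real_inner_smul_right, real_inner_smul_right,
      real_inner_self_eq_norm_sq, hθ, real_inner_comm θ b]
    ring_nf
  simp only [hpoint] at h
  rw [← sphereMeasure, integral_sub (Continuous.integrable_sphereMeasure_s19 (by fun_prop))
    (Continuous.integrable_sphereMeasure_s19 (by fun_prop)), integral_const_mul] at h
  linarith

theorem iSup_vMFgamma_sq {θ : EuclideanSpace ℝ (Fin d)} (hθ : ‖θ‖ = 1) (κ : ℝ) :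
    ⨆ b : Metric.sphere (0 : EuclideanSpace ℝ (Fin d)) 1, (vMFgamma d θ κ b) ^ 2
      = (vMFgamma d θ κ ⟨θ, by simpa using hθ⟩) ^ 2 := by
  have hb (b : Metric.sphere (0 : EuclideanSpace ℝ (Fin d)) 1) :
      (vMFgamma d θ κ b) ^ 2 ≤ (vMFgamma d θ κ ⟨θ, by simpa using hθ⟩) ^ 2 := by
    have hγ : vMFgamma d θ κ b
        = ⟪θ, (b : EuclideanSpace ℝ (Fin d))⟫_ℝ * vMFgamma d θ κ ⟨θ, by simpa using hθ⟩ := by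
      unfold vMFgamma
      rw [integral_inner_mul_comp_inner hθ b (g := fun t => Real.exp (κ * t)) (by fun_prop)]
      ring
    have hle : |⟪θ, (b : EuclideanSpace ℝ (Fin d))⟫_ℝ| ≤ 1 := by
      simpa [hθ] using abs_real_inner_le_norm θ (b : EuclideanSpace ℝ (Fin d))
    rw [hγ, mul_pow]
    exact mul_le_of_le_one_left (sq_nonneg _) ((sq_le_one_iff_abs_le_one _).2 hle)
  have : Nonempty (Metric.sphere (0 : EuclideanSpace ℝ (Fin d)) 1) := ⟨⟨θ, by simpa using hθ⟩⟩
  exact le_antisymm (ciSup_le hb) (le_ciSup (f := fun b => (vMFgamma d θ κ b) ^ 2)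
    ⟨_, Set.forall_mem_range.2 hb⟩ ⟨θ, by simpa using hθ⟩)

open ProbabilityTheory in
theorem hasDerivAt_integral_inner_pow_mul_exp (θ : EuclideanSpace ℝ (Fin d)) (n : ℕ) (κ : ℝ) :
    HasDerivAt (fun κ : ℝ => ∫ x, ⟪θ, (x : EuclideanSpace ℝ (Fin d))⟫_ℝ ^ n *
        Real.exp (κ * ⟪θ, (x : EuclideanSpace ℝ (Fin d))⟫_ℝ) ∂(sphereMeasure d))
      (∫ x, ⟪θ, (x : EuclideanSpace ℝ (Fin d))⟫_ℝ ^ (n + 1) *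
        Real.exp (κ * ⟪θ, (x : EuclideanSpace ℝ (Fin d))⟫_ℝ) ∂(sphereMeasure d)) κ := by
  apply hasDerivAt_integral_pow_mul_exp_real
    (X := fun x : Metric.sphere (0 : EuclideanSpace ℝ (Fin d)) 1 =>
      ⟪θ, (x : EuclideanSpace ℝ (Fin d))⟫_ℝ)
  have huniv : integrableExpSet (fun x : Metric.sphere (0 : EuclideanSpace ℝ (Fin d)) 1 =>
      ⟪θ, (x : EuclideanSpace ℝ (Fin d))⟫_ℝ) (sphereMeasure d) = Set.univ :=
    Set.eq_univ_of_forall fun t => Continuous.integrable_sphereMeasure_s19 (by fun_prop)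
  simp [huniv]

/-- If `L` vanishes at `0` and `L' / κ` tends to `c ≠ 0` at `0⁺`, then
`L' ^ 2 / (2 (κ L' - L))` tends to `c` at `0⁺`. -/
theorem tendsto_sq_deriv_div_legendre {L L' : ℝ → ℝ} {c : ℝ} (hc : c ≠ 0)
    (hL : ∀ κ, HasDerivAt L (L' κ) κ) (hL0 : L 0 = 0)
    (hL' : Tendsto (fun κ => L' κ / κ) (𝓝[>] 0) (𝓝 c)) :
    Tendsto (fun κ => L' κ ^ 2 / (2 * (κ * L' κ - L κ))) (𝓝[>] 0) (𝓝 c) := by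
  have hquad : Tendsto (fun κ => L κ / κ ^ 2) (𝓝[>] 0) (𝓝 (c / 2)) := by
    refine HasDerivAt.lhopital_zero_nhdsGT (f' := L') (g' := fun κ => 2 * κ)
      (.of_forall hL) (.of_forall fun κ => by simpa using hasDerivAt_pow 2 κ)
      (eventually_mem_nhdsWithin.mono fun κ hκ => by
        have : (0 : ℝ) < κ := hκ
        positivity) ?_ ?_ ?_
    · simpa [hL0] using (hL 0).continuousAt.tendsto.mono_left nhdsWithin_le_nhds
    · have h : Tendsto (fun κ : ℝ => κ ^ 2) (𝓝 0) (𝓝 (0 ^ 2)) := (continuous_pow 2).tendsto 0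
      simpa using h.mono_left nhdsWithin_le_nhds
    · refine (hL'.div_const 2).congr fun κ => ?_
      rw [div_div, mul_comm]
  have hlim := (hL'.pow 2).div ((hL'.sub hquad).const_mul 2)
    (by rw [sub_half]; simpa using hc)
  have hval : c ^ 2 / (2 * (c - c / 2)) = c := by
    field_simp
    ring
  rw [hval] at hlim
  refine hlim.congr' (eventually_mem_nhdsWithin.mono fun κ hκ => ?_)
  have hκ0 : κ ≠ 0 := ne_of_gt hκ
  have hden : 2 * (L' κ / κ - L κ / κ ^ 2) = 2 * (κ * L' κ - L κ) / κ ^ 2 := by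
    field_simp
  simp only [Pi.div_apply, hden, div_pow]
  exact div_div_div_cancel_right₀ (pow_ne_zero 2 hκ0) _ _

end

/-- Local Bahadur optimality of the Rayleigh test against von Mises–Fisher
alternatives: `lim_{κ → 0⁺} (sup_{b ∈ S^{d-1}} γ_κ(b)²) / (2 KL(κ)) = 1/d`. -/
theorem rayleigh_local_bahadur_vMF (d : ℕ) (hd : 2 ≤ d)
    (θ : EuclideanSpace ℝ (Fin d))
    (hθ : θ ∈ Metric.sphere (0 : EuclideanSpace ℝ (Fin d)) 1) :
    Tendsto (fun κ : ℝ =>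
        (⨆ b : Metric.sphere (0 : EuclideanSpace ℝ (Fin d)) 1,
          (vMFgamma d θ κ b) ^ 2) / (2 * vMFKL d θ κ))
      (nhdsWithin 0 (Set.Ioi 0)) (nhds (1 / (d : ℝ))) := by
  have hd0 : 0 < d := by lia
  have hθ1 : ‖θ‖ = 1 := by simpa using hθ
  have hN := sphereMeasure_real_univ_pos hd0
  set N := (sphereMeasure d).real Set.univ
  set M := vMFconst d θ
  set M' : ℝ → ℝ := fun κ => ∫ x, ⟪θ, (x : EuclideanSpace ℝ (Fin d))⟫_ℝ *
    Real.exp (κ * ⟪θ, (x : EuclideanSpace ℝ (Fin d))⟫_ℝ) ∂(sphereMeasure d)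
  have hM (κ : ℝ) : HasDerivAt M (M' κ) κ := by
    have h := hasDerivAt_integral_inner_pow_mul_exp θ 0 κ
    simp only [pow_zero, one_mul, zero_add, pow_one] at h
    exact h
  have hM' : HasDerivAt M' (N / d) 0 := by
    simpa [M', integral_inner_sq_sphereMeasure hd0 hθ1]
      using hasDerivAt_integral_inner_pow_mul_exp θ 1 0
  have hM0 : M 0 = N := by simp [M, N, vMFconst]
  have hM'0 : M' 0 = 0 := by simpa [M'] using integral_inner_sphereMeasure θ
  have hMpos (κ : ℝ) : 0 < M κ := by
    have : NeZero (sphereMeasure d) := ⟨fun h => by simp [N, h] at hN⟩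
    exact integral_exp_pos (Continuous.integrable_sphereMeasure_s19 (by fun_prop))
  have hlog (κ : ℝ) : HasDerivAt (fun κ => Real.log (M κ / N)) (M' κ / M κ) κ := by
    convert ((hM κ).div_const N).log (div_pos (hMpos κ) hN).ne' using 1
    have := (hMpos κ).ne'
    field_simp
  have hslope : Tendsto (fun κ => M' κ / M κ / κ) (𝓝[>] 0) (𝓝 (1 / (d : ℝ))) := by
    have h1 : Tendsto (fun κ => M' κ / κ) (𝓝[>] 0) (𝓝 (N / d)) := by
      have h := hM'.tendsto_slope_zero_right
      simpa [hM'0, div_eq_inv_mul] using h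
    have h2 : Tendsto M (𝓝[>] 0) (𝓝 N) :=
      hM0 ▸ (hM 0).continuousAt.tendsto.mono_left nhdsWithin_le_nhds
    have h := h1.div h2 hN.ne'
    rw [div_right_comm, div_self hN.ne'] at h
    exact h.congr fun κ => div_right_comm _ _ _
  have hmain := tendsto_sq_deriv_div_legendre (by positivity) hlog
    (by simp [hM0, hN.ne']) hslope
  refine hmain.congr fun κ => ?_
  rw [iSup_vMFgamma_sq hθ1]
  have hγ : vMFgamma d θ κ ⟨θ, hθ⟩ = M' κ / M κ := (div_eq_inv_mul _ _).symm
  have hKL : vMFKL d θ κ = κ * (M' κ / M κ) - Real.log (M κ / N) := by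
    rw [← mul_div_assoc, mul_div_right_comm]
    rfl
  rw [hγ, hKL]
end
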